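/- Let G be a finite simple graph in which every vertex has degree at least 2, let r be a positive integer, and suppose the girth of G is greater than 2r. Then for every vertex v and every integer a with 0 ≤ a ≤ r, the ball of radius r around v contains at least (r − a + 1)·|S_a(v)| vertices, i.e., |{u : dist(v, u) ≤ r}| ≥ (r − a + 1)·|S_a(v)|. -/

import Mathlib

namespace SimpleGraph

variable {V : Type*} {G : SimpleGraph V} {v u x y : V} {k : ℕ}

/-- A shortest path from `v` to a neighbor `x` of `u` that is no farther from `v` than `u`
extends to a path from `v` to `u`. -/
lemma exists_isPath_penultimate_eq (hx : G.edist v x ≤ k) (hu : k ≤ G.edist v u)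
    (hxu : G.Adj x u) :
    ∃ p : G.Walk v u, p.IsPath ∧ p.length ≤ k + 1 ∧ p.penultimate = x := by
  classical
  have hr : G.Reachable v x :=
    reachable_of_edist_ne_top (ne_top_of_le_ne_top (ENat.natCast_ne_top k) hx)
  obtain ⟨p, hp, hl⟩ := hr.exists_path_of_dist
  have hk : p.length ≤ k := by
    rw [hl]
    rw [← hr.coe_dist_eq_edist] at hx
    exact_mod_cast hx
  refine ⟨p.concat hxu, hp.concat ?_ hxu, ?_, ?_⟩
  · intro hmem
    have hlt := p.length_takeUntil_lt_length hmem hxu.ne'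
    have hle := hu.trans (edist_le (p.takeUntil u hmem))
    norm_cast at hle
    omega
  · simpa using hk
  · simp

/-- In a graph of large girth, a vertex `u` at distance at least `k` from `v` has at most one
neighbor at distance at most `k` from `v`. -/
lemma eq_of_adj_of_edist_le_of_lt_egirth (hg : (2 * (k + 1) : ℕ) < G.egirth)
    (hu : k ≤ G.edist v u) (hxu : G.Adj x u) (hyu : G.Adj y u)
    (hx : G.edist v x ≤ k) (hy : G.edist v y ≤ k) : x = y := by
  obtain ⟨p, hp, hpl, rfl⟩ := exists_isPath_penultimate_eq hx hu hxu
  obtain ⟨q, hq, hql, rfl⟩ := exists_isPath_penultimate_eq hy hu hyu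
  by_contra hne
  have hpq : p ≠ q := fun h ↦ hne (by rw [h])
  obtain ⟨w, -, -, c, hc, hcl⟩ := hp.exists_isCycle_length_le_add_of_ne hq hpq
  have := hg.trans_le (egirth_le_length hc)
  norm_cast at this
  omega

lemma exists_adj_edist_eq_add_one [Fintype V] [DecidableRel G.Adj]
    (hdeg : 2 ≤ G.degree u) (hg : (2 * (k + 1) : ℕ) < G.egirth) (hu : G.edist v u = k) :
    ∃ x, G.Adj x u ∧ G.edist v x = (k + 1 : ℕ) := by
  obtain ⟨x, hx, y, hy, hxy⟩ := Finset.one_lt_card.mp (show 1 < (G.neighborFinset u).card from hdeg)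
  rw [mem_neighborFinset] at hx hy
  have key : ∀ z, G.Adj u z → ¬ G.edist v z ≤ k → G.edist v z = (k + 1 : ℕ) := by
    intro z hz hlt
    refine le_antisymm ?_ (by simpa using Order.add_one_le_of_lt (not_le.mp hlt))
    calc G.edist v z ≤ G.edist v u + G.edist u z := SimpleGraph.edist_triangle
      _ = (k + 1 : ℕ) := by rw [hu, edist_eq_one_iff_adj.mpr hz]; rfl
  by_cases h : G.edist v x ≤ k
  · refine ⟨y, hy.symm, key y hy fun h' ↦ hxy ?_⟩
    exact eq_of_adj_of_edist_le_of_lt_egirth hg hu.ge hx.symm hy.symm h h'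
  · exact ⟨x, hx.symm, key x hx h⟩

lemma ncard_sphere_le_ncard_sphere_add_one [Fintype V] [DecidableRel G.Adj]
    (hdeg : ∀ u, 2 ≤ G.degree u) (hg : (2 * (k + 1) : ℕ) < G.egirth) :
    {u | G.edist v u = k}.ncard ≤ {u | G.edist v u = (k + 1 : ℕ)}.ncard := by
  have h (u : V) (hu : G.edist v u = k) := exists_adj_edist_eq_add_one (hdeg u) hg hu
  choose! f hadj hf using h
  refine Set.ncard_le_ncard_of_injOn f hf ?_ (Set.toFinite _)
  intro x (hx : _ = _) y (hy : _ = _) hxy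
  refine eq_of_adj_of_edist_le_of_lt_egirth hg ?_ (hadj x hx).symm
    (hxy ▸ (hadj y hy).symm) hx.le hy.le
  rw [hf x hx]
  exact_mod_cast k.le_succ

lemma ncard_closedBall_add_one [Finite V] (v : V) (k : ℕ) :
    {u | G.edist v u ≤ (k + 1 : ℕ)}.ncard =
      {u | G.edist v u ≤ k}.ncard + {u | G.edist v u = (k + 1 : ℕ)}.ncard := by
  rw [← Set.ncard_union_eq _ (Set.toFinite _) (Set.toFinite _)]
  · congr 1
    ext u
    simp only [Set.mem_ofPred_eq, Set.mem_union]
    cases G.edist v u using ENat.recTopCoe with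
    | top => simp [-Nat.cast_add, (ENat.natCast_ne_top _).symm]
    | coe n => norm_cast; omega
  · refine Set.disjoint_left.mpr fun u
      (hu : G.edist v u ≤ k) (hu' : G.edist v u = _) ↦ ?_
    rw [hu'] at hu
    norm_cast at hu
    omega

end SimpleGraph

/-- In a graph of minimum degree at least `2` and girth greater than `2r`, for every
vertex `v` and every `0 ≤ a ≤ r`, the ball of radius `r` around `v` contains at least
`(r - a + 1) · |S_a(v)|` vertices. -/
theorem ball_card_ge {V : Type*} [Fintype V] (G : SimpleGraph V)
    [DecidableRel G.Adj]
    (hdeg : ∀ v : V, 2 ≤ G.degree v)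
    (r : ℕ) (hr : 0 < r) (hg : (2 * r : ℕ) < G.egirth)
    (v : V) (a : ℕ) (ha : a ≤ r) :
    (r - a + 1) * {u : V | G.edist v u = (a : ℕ)}.ncard ≤
      {u : V | G.edist v u ≤ (r : ℕ)}.ncard := by
  clear hr
  suffices h : {u : V | G.edist v u = (a : ℕ)}.ncard ≤ {u : V | G.edist v u = (r : ℕ)}.ncard ∧
      (r - a + 1) * {u : V | G.edist v u = (a : ℕ)}.ncard ≤
        {u : V | G.edist v u ≤ (r : ℕ)}.ncard from h.2
  induction r, ha using Nat.le_induction with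
  | base =>
    refine ⟨le_rfl, ?_⟩
    rw [Nat.sub_self, zero_add, one_mul]
    exact Set.ncard_le_ncard (fun u hu ↦ le_of_eq hu) (Set.toFinite _)
  | succ r ha ih =>
    obtain ⟨hsphere, hball⟩ := ih (lt_of_le_of_lt (by norm_cast; omega) hg)
    have hstep := hsphere.trans
      (SimpleGraph.ncard_sphere_le_ncard_sphere_add_one (v := v) hdeg hg)
    refine ⟨hstep, ?_⟩
    rw [SimpleGraph.ncard_closedBall_add_one, Nat.sub_add_comm ha, add_one_mul]
    exact add_le_add hball hstep
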